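/- arXiv:2004.09079 — 4 statements merged into one kernel-verified Lean document; each statement's English description precedes it below -/
import Mathlib

section
/- Let μ be a probability distribution on the k-element subsets of [n] (k ≥ 1) whose generating polynomial g_μ is log-concave, let p : [n] → ℝ_{>0}, and let ε ≥ 0. If k·p(i) ≥ (1+ε)^{−1} · P_{S∼μ}[i ∈ S] for all i ∈ [n], then for every integer t ≥ k and every sequence τ ∈ [n]^t, Z_{μ,p}(τ) = ∑_{S ∈ binom([t],k)} μ(τ_S) · ∏_{i∈S} p(τ_i)^{−1} ≤ ((1+ε)·t)^k. -/
open Finset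

/-- A probability distribution on the `k`-element subsets of `[n]`:
nonnegative, supported on `k`-element sets, summing to `1`. -/
def IsProbDistOn (n k : ℕ) (μ : Finset (Fin n) → ℝ) : Prop :=
  (∀ S, 0 ≤ μ S) ∧ (∀ S, S.card ≠ k → μ S = 0) ∧ (∑ S : Finset (Fin n), μ S = 1)

/-- The generating polynomial `g_μ(z) = ∑_{|S|=k} μ(S) ∏_{i∈S} z_i`. -/
noncomputable def genPoly (n k : ℕ) (μ : Finset (Fin n) → ℝ) (z : Fin n → ℝ) : ℝ :=
  ∑ S ∈ Finset.univ.filter (fun S : Finset (Fin n) => S.card = k), μ S * ∏ i ∈ S, z i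

/-- `g` is log-concave as a function on `ℝ_{≥0}^n`. -/
def IsLogConcaveOn (n : ℕ) (g : (Fin n → ℝ) → ℝ) : Prop :=
  ∀ x y : Fin n → ℝ, (∀ i, 0 ≤ x i) → (∀ i, 0 ≤ y i) →
    ∀ lam : ℝ, 0 < lam → lam < 1 →
      g x ^ lam * g y ^ (1 - lam) ≤ g (fun i => lam * x i + (1 - lam) * y i)

/-- The marginal `P_{S∼μ}[i ∈ S]`. -/
noncomputable def marginal (n : ℕ) (μ : Finset (Fin n) → ℝ) (i : Fin n) : ℝ :=
  ∑ S ∈ Finset.univ.filter (fun S : Finset (Fin n) => i ∈ S), μ S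

/-- Choosing one point from each fibre of `τ` over `T` amounts to choosing a set which `τ` maps
bijectively onto `T`. -/
theorem sum_prod_transversal {ι α : Type*} [Fintype ι] [DecidableEq ι] [DecidableEq α]
    (τ : ι → α) (T : Finset α) (y : ι → ℝ) :
    ∑ S : Finset ι with S.card = T.card ∧ S.image τ = T, ∏ j ∈ S, y j =
      ∏ a ∈ T, ∑ j : ι with τ j = a, y j := by
  rw [Finset.prod_sum]
  symm
  have key : ∀ f ∈ T.pi (fun a => Finset.univ.filter (fun j : ι => τ j = a)),
      ∀ a (ha : a ∈ T), τ (f a ha) = a := by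
    intro f hf a ha
    simpa using Finset.mem_pi.1 hf a ha
  have inj : ∀ f ∈ T.pi (fun a => Finset.univ.filter (fun j : ι => τ j = a)),
      Function.Injective (fun a : {x // x ∈ T} => f a.1 a.2) := by
    intro f hf a b hab
    have h := congrArg τ hab
    simp only [key f hf] at h
    exact Subtype.ext h
  refine Finset.sum_bij (fun f _ => T.attach.image (fun a => f a.1 a.2)) ?_ ?_ ?_ ?_
  · intro f hf
    simp only [Finset.mem_filter, Finset.mem_univ, true_and]
    refine ⟨by rw [Finset.card_image_of_injective _ (inj f hf), Finset.card_attach], ?_⟩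
    rw [Finset.image_image]
    ext a
    simp only [Finset.mem_image, Finset.mem_attach, Function.comp_apply, true_and,
      Subtype.exists, key f hf]
    simp
  · intro f hf g hg hfg
    funext a ha
    have hmem : f a ha ∈ T.attach.image (fun a => g a.1 a.2) := by
      rw [← hfg]
      exact Finset.mem_image.2 ⟨⟨a, ha⟩, Finset.mem_attach _ _, rfl⟩
    obtain ⟨⟨b, hb⟩, -, h⟩ := Finset.mem_image.1 hmem
    have hab := congrArg τ h
    simp only [key f hf, key g hg] at hab
    subst hab
    exact h.symm
  · intro S hS
    simp only [Finset.mem_filter, Finset.mem_univ, true_and] at hS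
    obtain ⟨hc, rfl⟩ := hS
    have hinj : Set.InjOn τ S := Finset.card_image_iff.1 hc.symm
    have hex : ∀ a ∈ S.image τ, ∃ j ∈ S, τ j = a := fun a ha => by simpa using ha
    choose f hfS hfτ using hex
    refine ⟨f, ?_, ?_⟩
    · rw [Finset.mem_pi]
      intro a ha
      simpa using hfτ a ha
    · ext j
      simp only [Finset.mem_image, Finset.mem_attach, true_and, Subtype.exists]
      constructor
      · rintro ⟨a, ha, rfl⟩
        exact hfS _ _
      · intro hj
        have ha : τ j ∈ S.image τ := Finset.mem_image_of_mem τ hj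
        exact ⟨τ j, Finset.mem_image.1 ha, hinj (hfS _ ha) hj (hfτ _ ha)⟩
  · intro f hf
    rw [Finset.prod_image (fun a _ b _ h => inj f hf h)]

/-- Summing `μ` over the images of `k`-subsets of the index set gives a value of the generating
polynomial. -/
theorem sum_image_eq_genPoly {n k t : ℕ} {μ : Finset (Fin n) → ℝ}
    (hsupp : ∀ S, S.card ≠ k → μ S = 0) (τ : Fin t → Fin n) (y : Fin t → ℝ) :
    ∑ S : Finset (Fin t) with S.card = k, μ (S.image τ) * ∏ j ∈ S, y j =
      genPoly n k μ (fun i => ∑ j : Fin t with τ j = i, y j) := by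
  unfold genPoly
  rw [← Finset.sum_fiberwise _ (fun S : Finset (Fin t) => S.image τ), Finset.sum_filter]
  refine Finset.sum_congr rfl fun T _ => ?_
  split_ifs with hT
  · rw [← sum_prod_transversal, Finset.mul_sum, Finset.filter_filter, hT]
    refine Finset.sum_congr rfl fun S hS => ?_
    rw [(Finset.mem_filter.1 hS).2.2]
  · refine Finset.sum_eq_zero fun S hS => ?_
    rw [(Finset.mem_filter.1 hS).2, hsupp T hT, zero_mul]

theorem genPoly_one {n k : ℕ} {μ : Finset (Fin n) → ℝ} (hμ : IsProbDistOn n k μ) :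
    genPoly n k μ (fun _ => 1) = 1 := by
  obtain ⟨-, hsupp, hsum⟩ := hμ
  rw [genPoly, Finset.sum_filter]
  refine Eq.trans ?_ hsum
  refine Finset.sum_congr rfl fun S _ => ?_
  split_ifs with h
  · simp
  · exact (hsupp S h).symm

/-- The marginals are the partial derivatives of the generating polynomial at the all-ones
vector. -/
theorem hasDerivAt_genPoly_one {n k : ℕ} {μ : Finset (Fin n) → ℝ}
    (hμ : IsProbDistOn n k μ) (w : Fin n → ℝ) :
    HasDerivAt (fun s : ℝ => genPoly n k μ (fun i => s * w i + (1 - s) * 1))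
      (∑ i, marginal n μ i * w i - k) 0 := by
  obtain ⟨-, hsupp, hsum⟩ := hμ
  have hlin (i : Fin n) : HasDerivAt (fun s : ℝ => s * w i + (1 - s) * 1) (w i - 1) 0 := by
    have h := ((hasDerivAt_id (0 : ℝ)).mul_const (w i)).add
      (((hasDerivAt_id (0 : ℝ)).const_sub 1).mul_const 1)
    refine (h.congr_deriv (by ring)).congr_of_eventuallyEq (Filter.Eventually.of_forall fun s => ?_)
    simp
  have hS (S : Finset (Fin n)) :
      HasDerivAt (fun s : ℝ => μ S * ∏ i ∈ S, (s * w i + (1 - s) * 1))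
        (μ S * ∑ i ∈ S, (w i - 1)) 0 := by
    have h := (HasDerivAt.fun_finsetProd (u := S) fun i _ => hlin i).const_mul (μ S)
    simpa using h
  have hd := HasDerivAt.fun_sum
    (u := Finset.univ.filter (fun S : Finset (Fin n) => S.card = k)) fun S _ => hS S
  refine hd.congr_deriv (Eq.symm ?_)
  have hterm : ∀ S : Finset (Fin n), (if S.card = k then μ S * ∑ i ∈ S, (w i - 1) else 0) =
      ∑ i, (if i ∈ S then μ S * w i else 0) - μ S * k := by
    intro S
    rw [← Finset.sum_filter, Finset.filter_mem_eq_inter, Finset.univ_inter, ← Finset.mul_sum]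
    split_ifs with h
    · rw [Finset.sum_sub_distrib, mul_sub]
      simp [h]
    · simp [hsupp S h]
  rw [Finset.sum_filter, Finset.sum_congr rfl fun S _ => hterm S, Finset.sum_sub_distrib,
    ← Finset.sum_mul, hsum, one_mul, Finset.sum_comm]
  congr 1
  refine Finset.sum_congr rfl fun i _ => ?_
  rw [marginal, Finset.sum_mul, Finset.sum_filter]

/-- The tangent bound for a log-concave generating polynomial at the all-ones vector. -/
theorem genPoly_le_one_of_sum_marginal_le {n k : ℕ} {μ : Finset (Fin n) → ℝ}
    (hμ : IsProbDistOn n k μ) (hlc : IsLogConcaveOn n (genPoly n k μ)) {w : Fin n → ℝ}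
    (hw : ∀ i, 0 ≤ w i) (hsum : ∑ i, marginal n μ i * w i ≤ k) :
    genPoly n k μ w ≤ 1 := by
  by_contra! hlt
  have hpos : 0 < genPoly n k μ w := by linarith
  have hexp : HasDerivAt (fun s : ℝ => genPoly n k μ w ^ s) (Real.log (genPoly n k μ w)) 0 := by
    simpa using (hasDerivAt_id (0 : ℝ)).const_rpow hpos
  have hd := ((hasDerivAt_genPoly_one hμ w).sub hexp).tendsto_slope_zero_right
  have hnonneg := ge_of_tendsto hd (b := 0) (by
    filter_upwards [Ioo_mem_nhdsGT (zero_lt_one' ℝ)] with s hs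
    have h := hlc w (fun _ => 1) hw (fun _ => zero_le_one) s hs.1 hs.2
    rw [genPoly_one hμ, Real.one_rpow, mul_one] at h
    have h0 : genPoly n k μ (fun i => 0 * w i + (1 - 0) * 1) = 1 := by
      simpa using genPoly_one hμ
    rw [zero_add, Pi.sub_apply, Pi.sub_apply, h0, Real.rpow_zero, sub_self, sub_zero,
      smul_eq_mul]
    exact mul_nonneg (inv_nonneg.2 hs.1.le) (sub_nonneg.2 h))
  linarith [Real.log_pos hlt]

theorem normalization_constant_bound
    (n k t : ℕ) (hk : 1 ≤ k) (hkn : k ≤ n) (ht : k ≤ t)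
    (μ : Finset (Fin n) → ℝ) (hμ : IsProbDistOn n k μ)
    (hlc : IsLogConcaveOn n (genPoly n k μ))
    (p : Fin n → ℝ) (hp : ∀ i, 0 < p i)
    (ε : ℝ) (hε : 0 ≤ ε)
    (hmarg : ∀ i, (1 + ε)⁻¹ * marginal n μ i ≤ (k : ℝ) * p i)
    (τ : Fin t → Fin n) :
    (∑ S ∈ Finset.univ.filter (fun S : Finset (Fin t) => S.card = k),
        μ (S.image τ) * ∏ i ∈ S, (p (τ i))⁻¹)
      ≤ ((1 + ε) * (t : ℝ)) ^ k := by
  have hε' : 0 < 1 + ε := by linarith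
  have ht0 : (0 : ℝ) < t := by exact_mod_cast hk.trans ht
  set s : ℝ := (1 + ε) * t with hs
  have hs0 : 0 < s := mul_pos hε' ht0
  have hscale : ∑ S : Finset (Fin t) with S.card = k, μ (S.image τ) * ∏ i ∈ S, (p (τ i))⁻¹ =
      s ^ k * ∑ S : Finset (Fin t) with S.card = k,
        μ (S.image τ) * ∏ i ∈ S, (s⁻¹ * (p (τ i))⁻¹) := by
    rw [Finset.mul_sum]
    refine Finset.sum_congr rfl fun S hS => ?_
    rw [Finset.prod_mul_distrib, Finset.prod_const, (Finset.mem_filter.1 hS).2, inv_pow]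
    field_simp
  rw [hscale, sum_image_eq_genPoly hμ.2.1 τ]
  refine mul_le_of_le_one_right (pow_pos hs0 k).le
    (genPoly_le_one_of_sum_marginal_le hμ hlc (fun i => ?_) ?_)
  · exact Finset.sum_nonneg fun j _ =>
      mul_nonneg (inv_nonneg.2 hs0.le) (inv_nonneg.2 (hp _).le)
  · have hterm (j : Fin t) : marginal n μ (τ j) * (s⁻¹ * (p (τ j))⁻¹) ≤ k / t := by
      have h := hmarg (τ j)
      have hpj := hp (τ j)
      rw [inv_mul_le_iff₀ hε'] at h
      rw [← mul_inv, ← div_eq_mul_inv, div_le_div_iff₀ (mul_pos hs0 hpj) ht0, hs]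
      nlinarith
    calc ∑ i, marginal n μ i * ∑ j : Fin t with τ j = i, s⁻¹ * (p (τ j))⁻¹
        = ∑ i, ∑ j : Fin t with τ j = i, marginal n μ (τ j) * (s⁻¹ * (p (τ j))⁻¹) := by
          refine Finset.sum_congr rfl fun i _ => ?_
          rw [Finset.mul_sum]
          refine Finset.sum_congr rfl fun j hj => ?_
          rw [(Finset.mem_filter.1 hj).2]
      _ = ∑ j : Fin t, marginal n μ (τ j) * (s⁻¹ * (p (τ j))⁻¹) := Finset.sum_fiberwise _ _ _
      _ ≤ ∑ _j : Fin t, (k : ℝ) / t := Finset.sum_le_sum fun j _ => hterm j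
      _ = k := by
          rw [Finset.sum_const, Finset.card_univ, Fintype.card_fin, nsmul_eq_mul]
          field_simp
end

section
/- Let μ be a probability distribution on the k-element subsets of [n] (k ≥ 1) whose generating polynomial g_μ is log-concave, with marginals q_i = P_{S∼μ}[i ∈ S]. Let ε, δ ∈ (0,1) and let s be an integer with s ≥ 192·n·ε^{−3}·k^{−1}·ln(2n/δ). Draw S₁,…,S_s independently from μ (i.e., consider the s-fold product measure μ^{⊗s}), and define q̂_i = (1/s)·∑_{j=1}^s 1[i ∈ S_j], T̂ = {i ∈ [n] : q̂_i ≥ εk/(3n)}, and p(i) = (1 − (3/4)ε)·q̂_i/k for i ∈ T̂, while for i ∉ T̂ (when [n]∖T̂ is nonempty) p(i) = (1 − ∑_{i'∈T̂} p(i')) / |[n]∖T̂|. Then with probability at least 1 − δ over the samples, k·p(i) ≥ (1−ε)·q_i for every i ∈ [n]. -/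
open Finset

open scoped Classical

/-- Empirical marginal `q̂_i = (1/s) ∑_{j=1}^s 1[i ∈ S_j]` of a tuple of samples. -/
noncomputable def empMarginal (n s : ℕ) (ω : Fin s → Finset (Fin n)) (i : Fin n) : ℝ :=
  (1 / (s : ℝ)) * ∑ j : Fin s, if i ∈ ω j then (1 : ℝ) else 0

/-- The set `T̂ = {i ∈ [n] : q̂_i ≥ εk/(3n)}` of empirically large marginals. -/
noncomputable def bigSet (n s k : ℕ) (ε : ℝ) (ω : Fin s → Finset (Fin n)) :
    Finset (Fin n) :=
  Finset.univ.filter (fun i => ε * (k : ℝ) / (3 * (n : ℝ)) ≤ empMarginal n s ω i)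

/-- The estimated sampling distribution `p` built from the samples `ω`. -/
noncomputable def estDist (n s k : ℕ) (ε : ℝ) (ω : Fin s → Finset (Fin n)) (i : Fin n) : ℝ :=
  if i ∈ bigSet n s k ε ω then
    (1 - (3 / 4) * ε) * empMarginal n s ω i / (k : ℝ)
  else
    (1 - ∑ i' ∈ bigSet n s k ε ω, (1 - (3 / 4) * ε) * empMarginal n s ω i' / (k : ℝ))
      / ((Finset.univ \ bigSet n s k ε ω).card : ℝ)

theorem exp_neg_le_quadratic {t : ℝ} (ht : 0 ≤ t) : Real.exp (-t) ≤ 1 - t + t ^ 2 / 2 := by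
  have h := Real.quadratic_le_exp_of_nonneg ht
  have hpos := Real.exp_pos (-t)
  have hmul : Real.exp (-t) * Real.exp t = 1 := by rw [← Real.exp_add]; simp
  have h1 : Real.exp (-t) * (1 + t + t ^ 2 / 2) ≤ 1 :=
    (mul_le_mul_of_nonneg_left h hpos.le).trans_eq hmul
  have h2 : 1 ≤ (1 - t + t ^ 2 / 2) * (1 + t + t ^ 2 / 2) := by
    nlinarith [sq_nonneg (t ^ 2)]
  exact le_of_mul_le_mul_right (h1.trans h2) (by positivity)

theorem marginal_nonneg {n k : ℕ} {μ : Finset (Fin n) → ℝ} (hμ : IsProbDistOn n k μ)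
    (i : Fin n) : 0 ≤ marginal n μ i :=
  Finset.sum_nonneg fun S _ => hμ.1 S

/-- The Laplace transform of the indicator of `i ∈ S` is at most that of a Poisson variable. -/
theorem sum_mul_exp_indicator_le {n k : ℕ} {μ : Finset (Fin n) → ℝ} (hμ : IsProbDistOn n k μ)
    (i : Fin n) (t : ℝ) :
    ∑ S, μ S * Real.exp (-t * if i ∈ S then (1 : ℝ) else 0) ≤
      Real.exp (marginal n μ i * (Real.exp (-t) - 1)) := by
  have h : ∑ S, μ S * Real.exp (-t * if i ∈ S then (1 : ℝ) else 0) =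
      marginal n μ i * (Real.exp (-t) - 1) + 1 := by
    calc _ = ∑ S, ((if i ∈ S then μ S else 0) * (Real.exp (-t) - 1) + μ S) := by
          refine Finset.sum_congr rfl fun S _ => ?_
          split_ifs <;> simp [mul_sub]
      _ = _ := by
          rw [marginal, Finset.sum_filter, Finset.sum_add_distrib, ← Finset.sum_mul, hμ.2.2]
  exact h ▸ Real.add_one_le_exp _

/-- Multiplicative Chernoff bound for the lower tail of the empirical marginal. -/
theorem sum_empMarginal_lt_le {n k s : ℕ} {μ : Finset (Fin n) → ℝ} (hμ : IsProbDistOn n k μ)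
    (hs : 0 < s) (i : Fin n) {η : ℝ} (hη : 0 ≤ η) :
    ∑ ω : Fin s → Finset (Fin n), (∏ j, μ (ω j)) *
        (if empMarginal n s ω i < (1 - η) * marginal n μ i then (1 : ℝ) else 0) ≤
      Real.exp (-(η ^ 2 / 2 * (s * marginal n μ i))) := by
  set q := marginal n μ i
  have hq : 0 ≤ q := marginal_nonneg hμ i
  have hs' : (0 : ℝ) < s := by exact_mod_cast hs
  calc _ ≤ ∑ ω : Fin s → Finset (Fin n), Real.exp (η * ((1 - η) * (s * q))) *
        ∏ j, (μ (ω j) * Real.exp (-η * if i ∈ ω j then (1 : ℝ) else 0)) := by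
        refine Finset.sum_le_sum fun ω _ => ?_
        rw [Finset.prod_mul_distrib, ← Real.exp_sum, ← Finset.mul_sum, mul_left_comm,
          ← Real.exp_add]
        refine mul_le_mul_of_nonneg_left ?_ (Finset.prod_nonneg fun j _ => hμ.1 _)
        split_ifs with h
        · rw [Real.one_le_exp_iff]
          have hemp : ∑ j : Fin s, (if i ∈ ω j then (1 : ℝ) else 0) =
              s * empMarginal n s ω i := by
            rw [empMarginal]; field_simp
          rw [hemp]
          nlinarith [mul_nonneg (mul_nonneg hη hs'.le) (sub_nonneg.2 h.le)]
        · exact (Real.exp_pos _).le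
    _ = Real.exp (η * ((1 - η) * (s * q))) *
        (∑ S, μ S * Real.exp (-η * if i ∈ S then (1 : ℝ) else 0)) ^ s := by
        rw [← Finset.mul_sum, Fintype.sum_pow]
    _ ≤ Real.exp (η * ((1 - η) * (s * q))) * Real.exp (q * (Real.exp (-η) - 1)) ^ s := by
        gcongr
        · exact Finset.sum_nonneg fun S _ => mul_nonneg (hμ.1 S) (Real.exp_pos _).le
        · exact sum_mul_exp_indicator_le hμ i η
    _ ≤ _ := by
        rw [← Real.exp_nat_mul, ← Real.exp_add, Real.exp_le_exp]
        nlinarith [mul_le_mul_of_nonneg_left (exp_neg_le_quadratic hη) (mul_nonneg hs'.le hq)]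

theorem sum_empMarginal {n s k : ℕ} (hs : 0 < s) {ω : Fin s → Finset (Fin n)}
    (hω : ∀ j, (ω j).card = k) : ∑ i, empMarginal n s ω i = k := by
  have hs' : (s : ℝ) ≠ 0 := by positivity
  simp only [empMarginal]
  rw [← Finset.mul_sum, Finset.sum_comm]
  simp [hω, hs']

theorem empMarginal_nonneg {n s : ℕ} (ω : Fin s → Finset (Fin n)) (i : Fin n) :
    0 ≤ empMarginal n s ω i :=
  mul_nonneg (by positivity) (Finset.sum_nonneg fun j _ => by split_ifs <;> norm_num)

/-- Outside the set of large empirical marginals, the estimate is bounded below. -/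
theorem le_mul_estDist_of_notMem_bigSet {n s k : ℕ} (hk : 1 ≤ k) (hs : 0 < s) {ε : ℝ}
    (hε0 : 0 < ε) (hε1 : ε < 1) {ω : Fin s → Finset (Fin n)} (hω : ∀ j, (ω j).card = k)
    {i : Fin n} (hi : i ∉ bigSet n s k ε ω) :
    3 / 4 * ε * k / n ≤ k * estDist n s k ε ω i := by
  have hk' : (0 : ℝ) < k := by exact_mod_cast hk
  have hsum : ∑ i' ∈ bigSet n s k ε ω, empMarginal n s ω i' ≤ k := by
    rw [← sum_empMarginal hs hω]
    exact Finset.sum_le_sum_of_subset_of_nonneg (Finset.subset_univ _)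
      fun i _ _ => empMarginal_nonneg ω i
  have hcard : 0 < (Finset.univ \ bigSet n s k ε ω).card :=
    Finset.card_pos.2 ⟨i, by simpa using hi⟩
  have hcard_le : (Finset.univ \ bigSet n s k ε ω).card ≤ n := by
    simpa using Finset.card_le_univ (Finset.univ \ bigSet n s k ε ω)
  have hnum : 3 / 4 * ε ≤
      1 - ∑ i' ∈ bigSet n s k ε ω, (1 - 3 / 4 * ε) * empMarginal n s ω i' / k := by
    rw [← Finset.sum_div, ← Finset.mul_sum, mul_div_assoc]
    have := mul_le_mul_of_nonneg_left ((div_le_one hk').2 hsum)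
      (show 0 ≤ 1 - 3 / 4 * ε by linarith)
    linarith
  rw [estDist, if_neg hi, mul_comm _ (k : ℝ), mul_div_assoc]
  gcongr
  exact le_trans (by positivity) hnum

/-- If every non-negligible marginal is not underestimated by more than a factor `1 - ε / 4`,
then the estimated distribution dominates all the marginals. -/
theorem marginal_le_mul_estDist {n s k : ℕ} (hk : 1 ≤ k) (hs : 0 < s) {ε : ℝ}
    (hε0 : 0 < ε) (hε1 : ε < 1) {μ : Finset (Fin n) → ℝ} (hμ : IsProbDistOn n k μ)
    {ω : Fin s → Finset (Fin n)} (hω : ∀ j, (ω j).card = k)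
    (h : ∀ i, ε * k / (3 * n) ≤ marginal n μ i →
      (1 - ε / 4) * marginal n μ i ≤ empMarginal n s ω i) (i : Fin n) :
    (1 - ε) * marginal n μ i ≤ k * estDist n s k ε ω i := by
  have hk' : (0 : ℝ) < k := by exact_mod_cast hk
  have hn : (0 : ℝ) < n := by exact_mod_cast i.pos
  have hq := marginal_nonneg hμ i
  have hthr : ε * k / (3 * n) = 4 / 9 * (3 / 4 * ε * k / n) := by field_simp; norm_num
  have hpos : 0 < 3 / 4 * ε * k / n := by positivity
  by_cases hi : i ∈ bigSet n s k ε ω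
  · have hemp : ε * k / (3 * n) ≤ empMarginal n s ω i := by simpa [bigSet] using hi
    have hle : (1 - ε / 4) * marginal n μ i ≤ empMarginal n s ω i := by
      rcases le_total (ε * k / (3 * n)) (marginal n μ i) with hlarge | hsmall
      · exact h i hlarge
      · nlinarith
    rw [estDist, if_pos hi, mul_div_cancel₀ _ hk'.ne']
    have := mul_le_mul_of_nonneg_left hle (show 0 ≤ 1 - 3 / 4 * ε by linarith)
    nlinarith [mul_nonneg (sq_nonneg ε) hq]
  · have hemp : empMarginal n s ω i < ε * k / (3 * n) := by simpa [bigSet] using hi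
    have hbound := le_mul_estDist_of_notMem_bigSet hk hs hε0 hε1 hω hi
    have hle : marginal n μ i ≤ 3 / 4 * ε * k / n := by
      by_contra! hlt
      have := h i (by linarith)
      nlinarith
    nlinarith

theorem marginal_estimation
    (n k : ℕ) (hk : 1 ≤ k) (hkn : k ≤ n)
    (μ : Finset (Fin n) → ℝ) (hμ : IsProbDistOn n k μ)
    (hlc : IsLogConcaveOn n (genPoly n k μ))
    (ε δ : ℝ) (hε0 : 0 < ε) (hε1 : ε < 1) (hδ0 : 0 < δ) (hδ1 : δ < 1)
    (s : ℕ)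
    (hs : 192 * (n : ℝ) * (ε ^ 3)⁻¹ * ((k : ℝ))⁻¹ * Real.log (2 * (n : ℝ) / δ) ≤ (s : ℝ)) :
    1 - δ ≤
      ∑ ω : Fin s → Finset (Fin n),
        (∏ j : Fin s, μ (ω j)) *
          (if ∀ i : Fin n, (1 - ε) * marginal n μ i ≤ (k : ℝ) * estDist n s k ε ω i
           then (1 : ℝ) else 0) := by
  have hk' : (0 : ℝ) < k := by exact_mod_cast hk
  have hn1 : (1 : ℝ) ≤ n := by exact_mod_cast hk.trans hkn
  have hn : (0 : ℝ) < n := by linarith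
  have hratio : 1 < 2 * (n : ℝ) / δ := by rw [lt_div_iff₀ hδ0]; linarith
  have hlog : 0 < Real.log (2 * (n : ℝ) / δ) := Real.log_pos hratio
  have hs0 : 0 < s := by
    have : (0 : ℝ) < s := lt_of_lt_of_le (by positivity) hs
    exact_mod_cast this
  have hs' : Real.log (2 * n / δ) ≤ (ε / 4) ^ 2 / 2 * (s * (ε * k / (3 * n))) := by
    have : (ε / 4) ^ 2 / 2 * (s * (ε * k / (3 * n))) = s * (ε ^ 3 * k / (96 * n)) := by
      field_simp; norm_num
    rw [this]
    refine le_trans ?_ (mul_le_mul_of_nonneg_right hs (by positivity))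
    have : 192 * (n : ℝ) * (ε ^ 3)⁻¹ * (k : ℝ)⁻¹ * Real.log (2 * n / δ) *
        (ε ^ 3 * k / (96 * n)) = 2 * Real.log (2 * n / δ) := by
      field_simp; ring
    linarith
  have htail : ∀ i, ε * k / (3 * n) ≤ marginal n μ i →
      ∑ ω : Fin s → Finset (Fin n), (∏ j, μ (ω j)) *
        (if empMarginal n s ω i < (1 - ε / 4) * marginal n μ i then (1 : ℝ) else 0) ≤ δ / n := by
    intro i hi
    calc _ ≤ _ := sum_empMarginal_lt_le hμ hs0 i (by positivity : 0 ≤ ε / 4)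
      _ ≤ Real.exp (-Real.log (2 * n / δ)) := by
          rw [Real.exp_le_exp, neg_le_neg_iff]
          refine hs'.trans ?_
          gcongr
      _ = δ / (2 * n) := by rw [Real.exp_neg, Real.exp_log (by linarith), inv_div]
      _ ≤ δ / n := by gcongr; linarith
  have htotal : ∑ ω : Fin s → Finset (Fin n), ∏ j, μ (ω j) = 1 := by
    rw [← Fintype.sum_pow, hμ.2.2, one_pow]
  set L : Finset (Fin n) := Finset.univ.filter fun i => ε * k / (3 * n) ≤ marginal n μ i with hL
  have hunion : ∑ ω : Fin s → Finset (Fin n), ∑ i ∈ L, (∏ j, μ (ω j)) *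
      (if empMarginal n s ω i < (1 - ε / 4) * marginal n μ i then (1 : ℝ) else 0) ≤ δ := by
    rw [Finset.sum_comm]
    calc _ ≤ ∑ i ∈ L, δ / n := Finset.sum_le_sum fun i hi => htail i (by simpa [hL] using hi)
      _ = L.card * (δ / n) := by simp
      _ ≤ n * (δ / n) := by
          gcongr
          simpa using Finset.card_le_univ L
      _ = δ := by field_simp
  calc 1 - δ ≤ _ := sub_le_sub_left hunion 1
    _ = ∑ ω : Fin s → Finset (Fin n), (∏ j, μ (ω j) - ∑ i ∈ L, (∏ j, μ (ω j)) *
        (if empMarginal n s ω i < (1 - ε / 4) * marginal n μ i then (1 : ℝ) else 0)) := by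
      rw [Finset.sum_sub_distrib, htotal]
    _ ≤ _ := by
      refine Finset.sum_le_sum fun ω _ => ?_
      rw [← Finset.mul_sum, ← mul_one_sub]
      have hW : 0 ≤ ∏ j, μ (ω j) := Finset.prod_nonneg fun j _ => hμ.1 _
      by_cases hω : ∀ j, (ω j).card = k
      · refine mul_le_mul_of_nonneg_left ?_ hW
        have hind : ∀ i ∈ L, (0 : ℝ) ≤
            if empMarginal n s ω i < (1 - ε / 4) * marginal n μ i then 1 else 0 :=
          fun i _ => by split_ifs <;> norm_num
        split_ifs with hgood
        · linarith [Finset.sum_nonneg hind]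
        · have : ∃ i ∈ L, empMarginal n s ω i < (1 - ε / 4) * marginal n μ i := by
            by_contra! hcon
            exact hgood (marginal_le_mul_estDist hk hs0 hε0 hε1 hμ hω
              fun i hi => hcon i (by simpa [hL] using hi))
          obtain ⟨i, hiL, hi⟩ := this
          have := Finset.single_le_sum hind hiL
          rw [if_pos hi] at this
          linarith
      · push Not at hω
        obtain ⟨j, hj⟩ := hω
        rw [Finset.prod_eq_zero (Finset.mem_univ j) (hμ.2.1 _ hj)]
        simp
end

section
/- Let μ be a probability distribution on the k-element subsets of [n], let U be a k-element subset with μ(U) ≥ 1/(2·binom(n,k)), and let λ ≥ 1. Define the probability distribution μ₀ on k-subsets by μ₀(S) = λ^{|S∩U|}·μ(S)/Z where Z = ∑_{|S|=k} λ^{|S∩U|}·μ(S). Then the total variation distance between the point mass 1_U and μ₀ satisfies ‖1_U − μ₀‖_TV = 1 − μ₀(U) ≤ 1/(λ·μ(U)) ≤ 2·binom(n,k)/λ. -/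
open Finset

/-- The total variation distance from a point mass at `a` to a probability vector `p` is `1 - p a`. -/
theorem half_sum_abs_pointMass_sub {α : Type*} [Fintype α] [DecidableEq α] (p : α → ℝ)
    (hp : ∀ x, 0 ≤ p x) (hsum : ∑ x, p x = 1) (a : α) :
    (1 / 2) * ∑ x, |(if x = a then (1 : ℝ) else 0) - p x| = 1 - p a := by
  have hle : p a ≤ 1 := hsum ▸ Finset.single_le_sum (fun x _ => hp x) (Finset.mem_univ a)
  have hrest : ∑ x ∈ Finset.univ.erase a, |(if x = a then (1 : ℝ) else 0) - p x|
      = ∑ x ∈ Finset.univ.erase a, p x := by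
    refine Finset.sum_congr rfl fun x hx => ?_
    rw [if_neg (Finset.ne_of_mem_erase hx), zero_sub, abs_neg, abs_of_nonneg (hp x)]
  have hsplit := Finset.add_sum_erase Finset.univ p (Finset.mem_univ a)
  rw [← Finset.add_sum_erase _ _ (Finset.mem_univ a), hrest, if_pos rfl,
    abs_of_nonneg (sub_nonneg.2 hle)]
  linarith

/-- Distinct finsets of equal cardinality meet in a strictly smaller set. -/
theorem card_inter_lt_of_card_eq {α : Type*} [DecidableEq α] {S U : Finset α}
    (hcard : S.card = U.card) (hne : S ≠ U) : (S ∩ U).card < U.card := by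
  refine Finset.card_lt_card (Finset.inter_subset_right.ssubset_of_ne fun h => hne ?_)
  exact (Finset.eq_of_subset_of_card_le (Finset.inter_eq_right.1 h) hcard.le).symm

theorem tilted_distribution_close_to_point_mass
    (n k : ℕ) (hk : 1 ≤ k) (hkn : k ≤ n)
    (μ : Finset (Fin n) → ℝ) (hμ : IsProbDistOn n k μ)
    (U : Finset (Fin n)) (hU : U.card = k)
    (hadm : 1 / (2 * (n.choose k : ℝ)) ≤ μ U)
    (lam : ℝ) (hlam : 1 ≤ lam)
    (Z : ℝ)
    (hZ : Z = ∑ S ∈ Finset.univ.filter (fun S : Finset (Fin n) => S.card = k),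
        lam ^ (S ∩ U).card * μ S)
    (μ₀ : Finset (Fin n) → ℝ)
    (hμ₀ : ∀ S, μ₀ S = lam ^ (S ∩ U).card * μ S / Z) :
    ((1 / 2) * ∑ S : Finset (Fin n), |(if S = U then (1 : ℝ) else 0) - μ₀ S|
        = 1 - μ₀ U)
      ∧ 1 - μ₀ U ≤ 1 / (lam * μ U)
      ∧ 1 / (lam * μ U) ≤ 2 * (n.choose k : ℝ) / lam := by
  obtain ⟨hnn, hsupp, hone⟩ := hμ
  have hchoose : (0 : ℝ) < n.choose k := by exact_mod_cast Nat.choose_pos hkn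
  have hpos : 0 < μ U := lt_of_lt_of_le (by positivity) hadm
  have hlam0 : 0 < lam := by linarith
  have hw : ∀ S, 0 ≤ lam ^ (S ∩ U).card * μ S := fun S => mul_nonneg (by positivity) (hnn S)
  have hZsum : ∑ S, lam ^ (S ∩ U).card * μ S = Z := by
    rw [hZ, Finset.sum_filter_of_ne]
    intro S _ hS
    by_contra hc
    exact hS (by rw [hsupp S hc, mul_zero])
  have hsplit := Finset.add_sum_erase Finset.univ (fun S => lam ^ (S ∩ U).card * μ S)
    (Finset.mem_univ U)
  simp only [hZsum, Finset.inter_self, hU] at hsplit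
  have hrest : ∑ S ∈ Finset.univ.erase U, lam ^ (S ∩ U).card * μ S ≤ lam ^ (k - 1) := by
    calc ∑ S ∈ Finset.univ.erase U, lam ^ (S ∩ U).card * μ S
        ≤ ∑ S ∈ Finset.univ.erase U, lam ^ (k - 1) * μ S := by
          refine Finset.sum_le_sum fun S hS => ?_
          by_cases hc : S.card = k
          · have := card_inter_lt_of_card_eq (hc.trans hU.symm) (Finset.ne_of_mem_erase hS)
            exact mul_le_mul_of_nonneg_right (pow_le_pow_right₀ hlam (by omega)) (hnn S)
          · simp [hsupp S hc]
      _ ≤ ∑ S, lam ^ (k - 1) * μ S :=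
          Finset.sum_le_sum_of_subset_of_nonneg (Finset.erase_subset _ _)
            fun S _ _ => mul_nonneg (by positivity) (hnn S)
      _ = lam ^ (k - 1) := by rw [← Finset.mul_sum, hone, mul_one]
  have hrest0 : 0 ≤ ∑ S ∈ Finset.univ.erase U, lam ^ (S ∩ U).card * μ S :=
    Finset.sum_nonneg fun S _ => hw S
  have hpow : lam ^ k = lam ^ (k - 1) * lam := by rw [← pow_succ, Nat.sub_add_cancel hk]
  have hUpos : 0 < lam ^ k * μ U := by positivity
  have hZpos : 0 < Z := by linarith
  refine ⟨half_sum_abs_pointMass_sub μ₀ (fun S => ?_) ?_ U, ?_, ?_⟩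
  · rw [hμ₀]
    exact div_nonneg (hw S) hZpos.le
  · simp only [hμ₀]
    rw [← Finset.sum_div, hZsum, div_self hZpos.ne']
  · rw [hμ₀, Finset.inter_self, hU]
    calc 1 - lam ^ k * μ U / Z = (Z - lam ^ k * μ U) / Z := by field_simp
      _ ≤ lam ^ (k - 1) / (lam ^ k * μ U) :=
          div_le_div₀ (by positivity) (by linarith) hUpos (by linarith)
      _ = 1 / (lam * μ U) := by
          rw [hpow]
          field_simp
  · rw [div_le_iff₀ (by positivity)] at hadm
    rw [div_le_div_iff₀ (by positivity) hlam0]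
    nlinarith
end

section
/- Let n > k ≥ 1, let μ₀ be a probability distribution on the k-element subsets of [n], and let U be a k-element subset such that ‖1_U − μ₀‖_TV ≤ 1/n. Define p : [n] → ℝ by p(i) = 1/(k+1) for i ∈ U and p(i) = 1/((k+1)(n−k)) for i ∉ U. Then p is a probability distribution on [n] and for every i ∈ [n], p(i) ≥ P_{S∼μ₀}[i ∈ S]/(k+1). -/
open Finset

theorem marginal_le_one {n k : ℕ} {μ : Finset (Fin n) → ℝ} (hμ : IsProbDistOn n k μ)
    (i : Fin n) : marginal n μ i ≤ 1 := by
  rw [← hμ.2.2, marginal]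
  exact sum_le_sum_of_subset_of_nonneg (filter_subset _ _) fun S _ _ => hμ.1 S

/-- Sets avoiding `i` carry the mass that the marginal of `i` misses. -/
theorem marginal_add_le_one {n k : ℕ} {μ : Finset (Fin n) → ℝ} (hμ : IsProbDistOn n k μ)
    {U : Finset (Fin n)} {i : Fin n} (hi : i ∉ U) : marginal n μ i + μ U ≤ 1 := by
  have hU : U ∉ univ.filter (fun S : Finset (Fin n) => i ∈ S) := by simpa using hi
  rw [← hμ.2.2, marginal, add_comm, ← sum_insert hU]
  exact sum_le_sum_of_subset_of_nonneg (subset_univ _) fun S _ _ => hμ.1 S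

theorem one_sub_le_tv_point_mass {n k : ℕ} {μ : Finset (Fin n) → ℝ} (hμ : IsProbDistOn n k μ)
    (U : Finset (Fin n)) :
    1 - μ U ≤ (1 / 2) * ∑ S : Finset (Fin n), |(if S = U then (1 : ℝ) else 0) - μ S| := by
  have h : ∑ S : Finset (Fin n), (μ S + if S = U then 1 - 2 * μ U else 0) ≤
      ∑ S : Finset (Fin n), |(if S = U then (1 : ℝ) else 0) - μ S| := by
    refine sum_le_sum fun S _ => ?_
    split_ifs with hS
    · subst hS
      linarith [le_abs_self (1 - μ S)]
    · linarith [neg_le_abs (0 - μ S)]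
  rw [sum_add_distrib, hμ.2.2, sum_ite_eq' univ U] at h
  simp only [mem_univ, if_true] at h
  linarith

theorem sampling_distribution_from_point_mass
    (n k : ℕ) (hk : 1 ≤ k) (hkn : k < n)
    (μ₀ : Finset (Fin n) → ℝ) (hμ₀ : IsProbDistOn n k μ₀)
    (U : Finset (Fin n)) (hU : U.card = k)
    (hTV : (1 / 2) * ∑ S : Finset (Fin n), |(if S = U then (1 : ℝ) else 0) - μ₀ S|
        ≤ 1 / (n : ℝ))
    (p : Fin n → ℝ)
    (hp : ∀ i, p i = if i ∈ U then 1 / ((k : ℝ) + 1)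
        else 1 / (((k : ℝ) + 1) * ((n : ℝ) - (k : ℝ)))) :
    (∀ i, 0 ≤ p i) ∧ (∑ i : Fin n, p i = 1)
      ∧ ∀ i, marginal n μ₀ i / ((k : ℝ) + 1) ≤ p i := by
  have hk0 : (0 : ℝ) < (k : ℝ) + 1 := by positivity
  have hnk : (0 : ℝ) < (n : ℝ) - k := sub_pos.2 (by exact_mod_cast hkn)
  refine ⟨fun i => ?_, ?_, fun i => ?_⟩
  · rw [hp]
    split_ifs <;> positivity
  · have hc : ((univ.filter (fun i => i ∉ U)).card : ℝ) = (n : ℝ) - k := by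
      rw [filter_not, filter_mem_eq_inter, univ_inter, card_sdiff_of_subset (subset_univ U),
        card_univ, Fintype.card_fin, hU, Nat.cast_sub hkn.le]
    simp only [hp]
    rw [sum_ite, sum_const, sum_const, nsmul_eq_mul, nsmul_eq_mul, hc, filter_mem_eq_inter,
      univ_inter, hU]
    field_simp
  · rw [hp]
    split_ifs with hi
    · gcongr
      exact marginal_le_one hμ₀ i
    · have hm : marginal n μ₀ i ≤ 1 / ((n : ℝ) - k) := by
        calc marginal n μ₀ i ≤ 1 - μ₀ U := by linarith [marginal_add_le_one hμ₀ hi]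
          _ ≤ 1 / (n : ℝ) := (one_sub_le_tv_point_mass hμ₀ U).trans hTV
          _ ≤ 1 / ((n : ℝ) - k) :=
            one_div_le_one_div_of_le hnk (sub_le_self _ (Nat.cast_nonneg k))
      rw [mul_comm, ← div_div]
      gcongr
end
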